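/- arXiv:1705.09779 — 5 statements merged into one kernel-verified Lean document; each statement's English description precedes it below -/
import Mathlib

section
/- For every substring x of T, Rrep_T(Lrep_T(x)) = Lrep_T(Rrep_T(x)); that is, extending x maximally to the right while preserving its set of beginning positions and then maximally to the left while preserving the resulting set of ending positions yields the same string as performing these two extensions in the opposite order. -/
/-- The set of beginning positions (starting offsets) of occurrences of `x` in `T`. -/
def BegPos {α : Type*} [DecidableEq α] (T x : List α) : Finset ℕ :=
  (Finset.range (T.length + 1)).filter (fun i => x <+: T.drop i)

/-- The set of ending positions (ending offsets) of occurrences of `x` in `T`. -/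
def EndPos {α : Type*} [DecidableEq α] (T x : List α) : Finset ℕ :=
  (Finset.range (T.length + 1)).filter (fun j => x <:+ T.take j)

/-- The number of occurrences of `x` in `T`. -/
def occ {α : Type*} [DecidableEq α] (T x : List α) : ℕ := (BegPos T x).card

/-- `L` is the `Lrep` function for `T`: for every substring `u` of `T`, `L u` is the
longest substring of `T` with the same set of beginning positions as `u`
(equivalently, every substring with the same beginning positions is a prefix of `L u`). -/
def IsLrepFun {α : Type*} [DecidableEq α] (T : List α) (L : List α → List α) : Prop :=
  ∀ u : List α, 1 ≤ occ T u →
    1 ≤ occ T (L u) ∧ BegPos T (L u) = BegPos T u ∧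
      ∀ z : List α, 1 ≤ occ T z → BegPos T z = BegPos T u → z <+: L u

/-- `R` is the `Rrep` function for `T`: for every substring `u` of `T`, `R u` is the
longest substring of `T` with the same set of ending positions as `u`
(equivalently, every substring with the same ending positions is a suffix of `R u`). -/
def IsRrepFun {α : Type*} [DecidableEq α] (T : List α) (R : List α → List α) : Prop :=
  ∀ u : List α, 1 ≤ occ T u →
    1 ≤ occ T (R u) ∧ EndPos T (R u) = EndPos T u ∧
      ∀ z : List α, 1 ≤ occ T z → EndPos T z = EndPos T u → z <:+ R u

theorem mem_BegPos_iff {α : Type*} [DecidableEq α] {T x : List α} {i : ℕ} :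
    i ∈ BegPos T x ↔ ∃ p s, T = p ++ x ++ s ∧ p.length = i := by
  simp only [BegPos, Finset.mem_filter, Finset.mem_range]
  constructor
  · rintro ⟨hi, s, hs⟩
    refine ⟨T.take i, s, ?_, ?_⟩
    · rw [List.append_assoc, hs, List.take_append_drop]
    · rw [List.length_take]
      omega
  · rintro ⟨p, s, rfl, rfl⟩
    refine ⟨by simp only [List.length_append]; omega, s, ?_⟩
    rw [List.append_assoc, List.drop_left]

theorem mem_EndPos_iff {α : Type*} [DecidableEq α] {T x : List α} {j : ℕ} :
    j ∈ EndPos T x ↔ ∃ p s, T = p ++ x ++ s ∧ (p ++ x).length = j := by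
  simp only [EndPos, Finset.mem_filter, Finset.mem_range]
  constructor
  · rintro ⟨hj, p, hp⟩
    refine ⟨p, T.drop j, ?_, ?_⟩
    · rw [hp, List.take_append_drop]
    · rw [hp, List.length_take]
      omega
  · rintro ⟨p, s, rfl, rfl⟩
    refine ⟨by rw [List.length_append (as := p ++ x)]; omega, p, ?_⟩
    rw [List.take_left]

theorem one_le_occ_iff {α : Type*} [DecidableEq α] {T x : List α} :
    1 ≤ occ T x ↔ ∃ p s, T = p ++ x ++ s := by
  rw [occ, Nat.one_le_iff_ne_zero, Finset.card_ne_zero]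
  constructor
  · rintro ⟨i, hi⟩
    obtain ⟨p, s, h, -⟩ := mem_BegPos_iff.1 hi
    exact ⟨p, s, h⟩
  · rintro ⟨p, s, h⟩
    exact ⟨_, mem_BegPos_iff.2 ⟨p, s, h, rfl⟩⟩

/-- Every occurrence of `x` in `T` is immediately preceded by `a`. -/
def AlwaysPreceded {α : Type*} (T x a : List α) : Prop :=
  ∀ p s, T = p ++ x ++ s → a <:+ p

/-- Every occurrence of `x` in `T` is immediately followed by `b`. -/
def AlwaysFollowed {α : Type*} (T x b : List α) : Prop :=
  ∀ p s, T = p ++ x ++ s → b <+: s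

theorem BegPos_append_eq_iff {α : Type*} [DecidableEq α] {T x b : List α} :
    BegPos T (x ++ b) = BegPos T x ↔ AlwaysFollowed T x b := by
  constructor
  · intro h p s hT
    have hmem : p.length ∈ BegPos T (x ++ b) := h ▸ mem_BegPos_iff.2 ⟨p, s, hT, rfl⟩
    obtain ⟨q, t, hq, hlen⟩ := mem_BegPos_iff.1 hmem
    have heq : p ++ (x ++ s) = q ++ (x ++ (b ++ t)) := by
      simpa only [List.append_assoc] using hT.symm.trans hq
    have hs := List.append_cancel_left (List.append_inj heq hlen.symm).2
    exact ⟨t, hs.symm⟩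
  · intro h
    ext i
    rw [mem_BegPos_iff, mem_BegPos_iff]
    constructor
    · rintro ⟨p, s, hT, hi⟩
      exact ⟨p, b ++ s, by simpa only [List.append_assoc] using hT, hi⟩
    · rintro ⟨p, s, hT, hi⟩
      obtain ⟨t, rfl⟩ := h p s hT
      exact ⟨p, t, by simpa only [List.append_assoc] using hT, hi⟩

theorem EndPos_append_eq_iff {α : Type*} [DecidableEq α] {T x a : List α} :
    EndPos T (a ++ x) = EndPos T x ↔ AlwaysPreceded T x a := by
  constructor
  · intro h p s hT
    have hmem : (p ++ x).length ∈ EndPos T (a ++ x) := h ▸ mem_EndPos_iff.2 ⟨p, s, hT, rfl⟩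
    obtain ⟨q, t, hq, hlen⟩ := mem_EndPos_iff.1 hmem
    have heq := (List.append_inj (hT.symm.trans hq) hlen.symm).1
    rw [← List.append_assoc] at heq
    exact ⟨q, (List.append_cancel_right heq).symm⟩
  · intro h
    ext j
    rw [mem_EndPos_iff, mem_EndPos_iff]
    constructor
    · rintro ⟨p, s, hT, hj⟩
      exact ⟨p ++ a, s, by simpa only [List.append_assoc] using hT,
        by simpa only [List.append_assoc] using hj⟩
    · rintro ⟨p, s, hT, hj⟩
      obtain ⟨q, rfl⟩ := h p s hT
      exact ⟨q, s, by simpa only [List.append_assoc] using hT,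
        by simpa only [List.append_assoc] using hj⟩

theorem AlwaysFollowed.one_le_occ {α : Type*} [DecidableEq α] {T x b : List α}
    (h : AlwaysFollowed T x b) (hx : 1 ≤ occ T x) : 1 ≤ occ T (x ++ b) := by
  rwa [occ, BegPos_append_eq_iff.2 h]

theorem AlwaysPreceded.one_le_occ {α : Type*} [DecidableEq α] {T x a : List α}
    (h : AlwaysPreceded T x a) (hx : 1 ≤ occ T x) : 1 ≤ occ T (a ++ x) := by
  obtain ⟨p, s, hT⟩ := one_le_occ_iff.1 hx
  obtain ⟨q, rfl⟩ := h p s hT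
  exact one_le_occ_iff.2 ⟨q, s, by simpa only [List.append_assoc] using hT⟩

theorem AlwaysFollowed.alwaysPreceded_append_iff {α : Type*} {T x a b : List α}
    (h : AlwaysFollowed T x b) : AlwaysPreceded T (x ++ b) a ↔ AlwaysPreceded T x a := by
  constructor
  · intro ha p s hT
    obtain ⟨t, rfl⟩ := h p s hT
    exact ha p t (by simpa only [List.append_assoc] using hT)
  · intro ha p s hT
    exact ha p (b ++ s) (by simpa only [List.append_assoc] using hT)

theorem AlwaysPreceded.alwaysFollowed_append_iff {α : Type*} {T x a b : List α}
    (h : AlwaysPreceded T x a) : AlwaysFollowed T (a ++ x) b ↔ AlwaysFollowed T x b := by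
  constructor
  · intro hb p s hT
    obtain ⟨q, rfl⟩ := h p s hT
    exact hb q s (by simpa only [List.append_assoc] using hT)
  · intro hb p s hT
    exact hb (p ++ a) s (by simpa only [List.append_assoc] using hT)

theorem IsLrepFun.exists_eq_append {α : Type*} [DecidableEq α] {T : List α}
    {L : List α → List α} (hL : IsLrepFun T L) {x : List α} (hx : 1 ≤ occ T x) :
    ∃ b, L x = x ++ b ∧ AlwaysFollowed T x b ∧ ∀ b', AlwaysFollowed T x b' → b' <+: b := by
  obtain ⟨-, hpos, hmax⟩ := hL x hx
  obtain ⟨b, hb⟩ := hmax x hx rfl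
  rw [← hb] at hpos hmax
  refine ⟨b, hb.symm, BegPos_append_eq_iff.1 hpos, fun b' h => ?_⟩
  exact (List.prefix_append_right_inj x).1
    (hmax _ (h.one_le_occ hx) (BegPos_append_eq_iff.2 h))

theorem IsRrepFun.exists_eq_append {α : Type*} [DecidableEq α] {T : List α}
    {R : List α → List α} (hR : IsRrepFun T R) {x : List α} (hx : 1 ≤ occ T x) :
    ∃ a, R x = a ++ x ∧ AlwaysPreceded T x a ∧ ∀ a', AlwaysPreceded T x a' → a' <:+ a := by
  obtain ⟨-, hpos, hmax⟩ := hR x hx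
  obtain ⟨a, ha⟩ := hmax x hx rfl
  rw [← ha] at hpos hmax
  refine ⟨a, ha.symm, EndPos_append_eq_iff.1 hpos, fun a' h => ?_⟩
  obtain ⟨c, hc⟩ := hmax _ (h.one_le_occ hx) (EndPos_append_eq_iff.2 h)
  rw [← List.append_assoc] at hc
  exact ⟨c, List.append_cancel_right hc⟩

theorem stmt2 {α : Type*} [Fintype α] [DecidableEq α] (T : List α)
    (L R : List α → List α) (hL : IsLrepFun T L) (hR : IsRrepFun T R)
    (x : List α) (hx : 1 ≤ occ T x) :
    R (L x) = L (R x) := by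
  obtain ⟨b, hLx, hb, hbmax⟩ := hL.exists_eq_append hx
  obtain ⟨a, hRx, ha, hamax⟩ := hR.exists_eq_append hx
  obtain ⟨a', hRLx, ha', hamax'⟩ := hR.exists_eq_append (hb.one_le_occ hx)
  obtain ⟨b', hLRx, hb', hbmax'⟩ := hL.exists_eq_append (ha.one_le_occ hx)
  have haa : a' = a :=
    (hamax a' (hb.alwaysPreceded_append_iff.1 ha')).eq_of_length_le
      (hamax' a (hb.alwaysPreceded_append_iff.2 ha)).length_le
  have hbb : b' = b :=
    (hbmax b' (ha.alwaysFollowed_append_iff.1 hb')).eq_of_length_le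
      (hbmax' b (ha.alwaysFollowed_append_iff.2 hb)).length_le
  rw [hLx, hRx, hRLx, hLRx, haa, hbb, List.append_assoc]
end

section
/- If x is a repeat of T (i.e., occ_T(x) ≥ 2), then β_T(x) := Rrep_T(Lrep_T(x)) is a maximal repeat of T, and occ_T(β_T(x)) = occ_T(x). -/
/-- `w` is a maximal repeat of `T`: a repeat whose every right extension `w·a` and
every left extension `a·w` occurs strictly fewer times in `T` than `w`. -/
def IsMaxRep {α : Type*} [DecidableEq α] (T w : List α) : Prop :=
  2 ≤ occ T w ∧ ∀ a : α, occ T (w ++ [a]) < occ T w ∧ occ T (a :: w) < occ T w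

theorem mem_BegPos {α : Type*} [DecidableEq α] {T x : List α} {i : ℕ} :
    i ∈ BegPos T x ↔ ∃ s t, s ++ x ++ t = T ∧ s.length = i := by
  simp only [BegPos, Finset.mem_filter, Finset.mem_range]
  constructor
  · rintro ⟨hi, t, ht⟩
    refine ⟨T.take i, t, ?_, ?_⟩
    · rw [List.append_assoc, ht, List.take_append_drop]
    · rw [List.length_take]; omega
  · rintro ⟨s, t, rfl, rfl⟩
    refine ⟨by simp only [List.length_append]; omega, t, ?_⟩
    rw [List.append_assoc, List.drop_left]

theorem mem_EndPos {α : Type*} [DecidableEq α] {T x : List α} {j : ℕ} :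
    j ∈ EndPos T x ↔ ∃ s t, s ++ x ++ t = T ∧ (s ++ x).length = j := by
  simp only [EndPos, Finset.mem_filter, Finset.mem_range]
  constructor
  · rintro ⟨hj, s, hs⟩
    refine ⟨s, T.drop j, ?_, ?_⟩
    · rw [hs, List.take_append_drop]
    · rw [hs, List.length_take]; omega
  · rintro ⟨s, t, rfl, rfl⟩
    refine ⟨by simp only [List.length_append]; omega, s, ?_⟩
    rw [List.take_left]

theorem EndPos_eq_image_BegPos {α : Type*} [DecidableEq α] (T x : List α) :
    EndPos T x = (BegPos T x).image (· + x.length) := by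
  ext j
  simp only [Finset.mem_image, mem_BegPos, mem_EndPos]
  constructor
  · rintro ⟨s, t, h, rfl⟩
    exact ⟨s.length, ⟨s, t, h, rfl⟩, List.length_append.symm⟩
  · rintro ⟨_, ⟨s, t, h, rfl⟩, rfl⟩
    exact ⟨s, t, h, List.length_append⟩

theorem card_EndPos {α : Type*} [DecidableEq α] (T x : List α) :
    (EndPos T x).card = occ T x := by
  rw [EndPos_eq_image_BegPos, Finset.card_image_of_injective _ (add_left_injective _), occ]

theorem BegPos_subset_of_prefix {α : Type*} [DecidableEq α] (T : List α) {x z : List α}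
    (h : x <+: z) : BegPos T z ⊆ BegPos T x :=
  Finset.monotone_filter_right _ fun _ _ hz => h.trans hz

theorem EndPos_subset_of_suffix {α : Type*} [DecidableEq α] (T : List α) {x z : List α}
    (h : x <:+ z) : EndPos T z ⊆ EndPos T x :=
  Finset.monotone_filter_right _ fun _ _ hz => h.trans hz

theorem occ_le_of_suffix {α : Type*} [DecidableEq α] (T : List α) {x z : List α}
    (h : x <:+ z) : occ T z ≤ occ T x := by
  simpa only [card_EndPos] using Finset.card_le_card (EndPos_subset_of_suffix T h)

/-- A right extension of `Lrep x` occurs strictly fewer times than `x`. -/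
theorem IsLrepFun.occ_append_singleton_lt {α : Type*} [DecidableEq α] {T : List α}
    {L : List α → List α} (hL : IsLrepFun T L) {x : List α} (hx : 1 ≤ occ T x) (a : α) :
    occ T (L x ++ [a]) < occ T x := by
  obtain ⟨-, hB, hmax⟩ := hL x hx
  by_contra! hle
  have hsub := hB ▸ BegPos_subset_of_prefix T (List.prefix_append (L x) [a])
  have hlen := (hmax _ (hx.trans hle) (Finset.eq_of_subset_of_card_le hsub hle)).length_le
  simp at hlen

/-- A left extension of `Rrep x` occurs strictly fewer times than `x`. -/
theorem IsRrepFun.occ_cons_lt {α : Type*} [DecidableEq α] {T : List α}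
    {R : List α → List α} (hR : IsRrepFun T R) {x : List α} (hx : 1 ≤ occ T x) (a : α) :
    occ T (a :: R x) < occ T x := by
  obtain ⟨-, hE, hmax⟩ := hR x hx
  by_contra! hle
  have hsub := hE ▸ EndPos_subset_of_suffix T (List.suffix_cons a (R x))
  have hcard : (EndPos T x).card ≤ (EndPos T (a :: R x)).card := by
    simpa only [card_EndPos] using hle
  have hlen := (hmax _ (hx.trans hle) (Finset.eq_of_subset_of_card_le hsub hcard)).length_le
  simp at hlen

theorem stmt3 {α : Type*} [Fintype α] [DecidableEq α] (T : List α)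
    (L R : List α → List α) (hL : IsLrepFun T L) (hR : IsRrepFun T R)
    (x : List α) (hx : 2 ≤ occ T x) :
    IsMaxRep T (R (L x)) ∧ occ T (R (L x)) = occ T x := by
  have hx1 : 1 ≤ occ T x := by omega
  obtain ⟨hy1, hB, -⟩ := hL x hx1
  obtain ⟨-, hE, hmax⟩ := hR (L x) hy1
  have hy : occ T (L x) = occ T x := congrArg Finset.card hB
  have hw : occ T (R (L x)) = occ T x := by
    rw [← hy, ← card_EndPos, hE, card_EndPos]
  refine ⟨⟨hw ▸ hx, fun a => ⟨?_, ?_⟩⟩, hw⟩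
  · obtain ⟨s, hs⟩ := hmax (L x) hy1 rfl
    have hsuf : L x ++ [a] <:+ R (L x) ++ [a] := ⟨s, by rw [← List.append_assoc, hs]⟩
    rw [hw]
    exact (occ_le_of_suffix T hsuf).trans_lt (hL.occ_append_singleton_lt hx1 a)
  · rw [hw, ← hy]
    exact hR.occ_cons_lt hy1 a
end

section
/- The image of the set of repeats of T under the map x ↦ Rrep_T(Lrep_T(x)) is exactly the set of maximal repeats of T; in particular, every maximal repeat of T is of the form Rrep_T(Lrep_T(x)) for some repeat x, and conversely. -/
section Occurrences

variable {α : Type*} [DecidableEq α] {T x y w : List α}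

theorem mem_begPos_iff {i : ℕ} :
    i ∈ BegPos T x ↔ ∃ p s : List α, T = p ++ x ++ s ∧ p.length = i := by
  simp only [BegPos, Finset.mem_filter, Finset.mem_range]
  constructor
  · rintro ⟨hi, s, hs⟩
    refine ⟨T.take i, s, ?_, ?_⟩
    · rw [List.append_assoc, hs, List.take_append_drop]
    · rw [List.length_take]; omega
  · rintro ⟨p, s, rfl, rfl⟩
    refine ⟨?_, ?_⟩
    · simp only [List.length_append]; omega
    · simp

theorem mem_endPos_iff {j : ℕ} :
    j ∈ EndPos T x ↔ ∃ p s : List α, T = p ++ x ++ s ∧ p.length + x.length = j := by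
  simp only [EndPos, Finset.mem_filter, Finset.mem_range]
  constructor
  · rintro ⟨hj, p, hp⟩
    refine ⟨p, T.drop j, ?_, ?_⟩
    · rw [hp, List.take_append_drop]
    · rw [← List.length_append, hp, List.length_take]; omega
  · rintro ⟨p, s, rfl, rfl⟩
    refine ⟨?_, ?_⟩
    · simp only [List.length_append]; omega
    · rw [← List.length_append, List.take_left]
      exact List.suffix_append p x

theorem endPos_eq_image_begPos : EndPos T x = (BegPos T x).image (· + x.length) := by
  ext j
  simp only [Finset.mem_image, mem_begPos_iff, mem_endPos_iff]
  constructor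
  · rintro ⟨p, s, h, rfl⟩
    exact ⟨p.length, ⟨p, s, h, rfl⟩, rfl⟩
  · rintro ⟨i, ⟨p, s, h, rfl⟩, rfl⟩
    exact ⟨p, s, h, rfl⟩

theorem add_length_mem_endPos_iff {i : ℕ} : i + x.length ∈ EndPos T x ↔ i ∈ BegPos T x := by
  simp [endPos_eq_image_begPos]

theorem card_endPos : (EndPos T x).card = occ T x := by
  rw [endPos_eq_image_begPos, occ]
  exact Finset.card_image_of_injective _ (add_left_injective _)

theorem begPos_subset_of_prefix (h : x <+: y) : BegPos T y ⊆ BegPos T x := by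
  intro i hi
  simp only [BegPos, Finset.mem_filter] at hi ⊢
  exact ⟨hi.1, h.trans hi.2⟩

theorem endPos_subset_of_suffix (h : x <:+ y) : EndPos T y ⊆ EndPos T x := by
  intro i hi
  simp only [EndPos, Finset.mem_filter] at hi ⊢
  exact ⟨hi.1, h.trans hi.2⟩

theorem occ_concat_lt_iff {a : α} :
    occ T (w ++ [a]) < occ T w ↔ BegPos T (w ++ [a]) ≠ BegPos T w := by
  have hsub : BegPos T (w ++ [a]) ⊆ BegPos T w := begPos_subset_of_prefix (List.prefix_append _ _)
  refine ⟨fun h e => ?_, fun h => Finset.card_lt_card (hsub.ssubset_of_ne h)⟩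
  rw [occ, occ, e] at h
  exact lt_irrefl _ h

theorem occ_cons_lt_iff {a : α} :
    occ T (a :: w) < occ T w ↔ EndPos T (a :: w) ≠ EndPos T w := by
  have hsub : EndPos T (a :: w) ⊆ EndPos T w := endPos_subset_of_suffix (List.suffix_cons _ _)
  rw [← card_endPos, ← card_endPos]
  refine ⟨fun h e => ?_, fun h => Finset.card_lt_card (hsub.ssubset_of_ne h)⟩
  rw [e] at h
  exact lt_irrefl _ h

/-- If `v ++ y` ends exactly where `y` does, then every right extension shared by all occurrences
of `v ++ y` is shared by all occurrences of `y`. -/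
theorem begPos_concat_eq_of_endPos_append_eq {v : List α} {a : α}
    (hE : EndPos T (v ++ y) = EndPos T y)
    (hB : BegPos T (v ++ y ++ [a]) = BegPos T (v ++ y)) :
    BegPos T (y ++ [a]) = BegPos T y := by
  refine (begPos_subset_of_prefix (List.prefix_append _ _)).antisymm fun i hi => ?_
  rw [← add_length_mem_endPos_iff, ← hE, endPos_eq_image_begPos, Finset.mem_image] at hi
  obtain ⟨k, hk, hki⟩ := hi
  rw [← hB, mem_begPos_iff] at hk
  obtain ⟨p, s, h, rfl⟩ := hk
  refine mem_begPos_iff.2 ⟨p ++ v, s, by simpa using h, ?_⟩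
  simp only [List.length_append] at hki ⊢
  omega

theorem IsMaxRep.eq_of_prefix (hw : IsMaxRep T w) (h : w <+: y) (hB : BegPos T y = BegPos T w) :
    y = w := by
  obtain ⟨t, rfl⟩ := h
  cases t with
  | nil => simp
  | cons a t =>
    refine absurd ?_ (occ_concat_lt_iff.1 (hw.2 a).1)
    refine (begPos_subset_of_prefix (List.prefix_append _ _)).antisymm ?_
    rw [← hB]
    exact begPos_subset_of_prefix ⟨t, by simp⟩

theorem IsMaxRep.eq_of_suffix (hw : IsMaxRep T w) (h : w <:+ y) (hE : EndPos T y = EndPos T w) :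
    y = w := by
  obtain ⟨t, rfl⟩ := h
  rcases List.eq_nil_or_concat t with rfl | ⟨t, a, rfl⟩
  · simp
  · refine absurd ?_ (occ_cons_lt_iff.1 (hw.2 a).2)
    refine (endPos_subset_of_suffix (List.suffix_cons _ _)).antisymm ?_
    rw [← hE]
    exact endPos_subset_of_suffix ⟨t, by simp⟩

theorem isMaxRep_rrep_lrep {L R : List α → List α} (hL : IsLrepFun T L) (hR : IsRrepFun T R)
    (hx : 2 ≤ occ T x) : IsMaxRep T (R (L x)) := by
  obtain ⟨hy, hyB, hyMax⟩ := hL x (by omega)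
  obtain ⟨-, hzE, hzMax⟩ := hR (L x) hy
  have hocc : occ T (R (L x)) = occ T x := by
    rw [← card_endPos, hzE, card_endPos, occ, hyB, occ]
  refine ⟨by omega, fun a => ⟨occ_concat_lt_iff.2 fun e => ?_, occ_cons_lt_iff.2 fun e => ?_⟩⟩
  · obtain ⟨v, hv⟩ := hzMax (L x) hy rfl
    rw [← hv] at hzE e
    have h := (begPos_concat_eq_of_endPos_append_eq hzE e).trans hyB
    have hlen := (hyMax (L x ++ [a]) (by rw [occ, h, ← occ]; omega) h).length_le
    simp at hlen
  · have hlen := (hzMax (a :: R (L x)) (by rw [← card_endPos, e, card_endPos]; omega)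
      (e.trans hzE)).length_le
    simp at hlen

theorem IsMaxRep.rrep_lrep_eq {L R : List α → List α} (hL : IsLrepFun T L) (hR : IsRrepFun T R)
    (hw : IsMaxRep T w) : R (L w) = w := by
  have h1 : 1 ≤ occ T w := one_le_two.trans hw.1
  obtain ⟨-, hB, hLmax⟩ := hL w h1
  obtain ⟨-, hE, hRmax⟩ := hR w h1
  rw [hw.eq_of_prefix (hLmax w h1 rfl) hB]
  exact hw.eq_of_suffix (hRmax w h1 rfl) hE

end Occurrences

theorem stmt5 {α : Type*} [Fintype α] [DecidableEq α] (T : List α)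
    (L R : List α → List α) (hL : IsLrepFun T L) (hR : IsRrepFun T R) :
    (fun x => R (L x)) '' {x : List α | 2 ≤ occ T x} = {w : List α | IsMaxRep T w} := by
  ext w
  constructor
  · rintro ⟨x, hx, rfl⟩
    exact isMaxRep_rrep_lrep hL hR hx
  · intro hw
    exact ⟨w, hw.1, hw.rrep_lrep_eq hL hR⟩
end

section
/- For any nonempty string T of length n ≥ 1, the number of nonempty maximal repeats of T is strictly less than n. -/
/-- The set of right extensions of maximal repeats of `T`: substrings of `T`
of the form `w·a` with `w` a maximal repeat of `T` and `a` a character. -/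
def RightExtSet {α : Type*} [DecidableEq α] (T : List α) : Set (List α) :=
  {x | ∃ (w : List α) (a : α), IsMaxRep T w ∧ x = w ++ [a] ∧ 1 ≤ occ T x}

/-- The set of left extensions of maximal repeats of `T`: substrings of `T`
of the form `a·w` with `w` a maximal repeat of `T` and `a` a character. -/
def LeftExtSet {α : Type*} [DecidableEq α] (T : List α) : Set (List α) :=
  {x | ∃ (w : List α) (a : α), IsMaxRep T w ∧ x = a :: w ∧ 1 ≤ occ T x}

theorem List.eq_of_append_singleton_isPrefix {α : Type*} {w s : List α} {a b : α}
    (ha : w ++ [a] <+: s) (hb : w ++ [b] <+: s) : a = b := by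
  have h := (List.prefix_of_prefix_length_le ha hb (by simp)).eq_of_length (by simp)
  simpa using h

/-- If `w` and `v` are prefixes of the same list, then they are equal or one of them
extends the other by at least one character. -/
theorem List.eq_or_append_singleton_isPrefix {α : Type*} {w v s : List α}
    (hw : w <+: s) (hv : v <+: s) :
    w = v ∨ (∃ a, w ++ [a] <+: v) ∨ ∃ a, v ++ [a] <+: w := by
  rcases List.prefix_or_prefix_of_prefix hw hv with ⟨t, rfl⟩ | ⟨t, rfl⟩
  · cases t with
    | nil => simp
    | cons a t => exact Or.inr (Or.inl ⟨a, t, by simp⟩)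
  · cases t with
    | nil => simp
    | cons a t => exact Or.inr (Or.inr ⟨a, t, by simp⟩)

section

variable {α : Type*} [DecidableEq α]

theorem mem_BegPos_s9 {T x : List α} {i : ℕ} :
    i ∈ BegPos T x ↔ i < T.length + 1 ∧ x <+: T.drop i := by
  simp [BegPos]

theorem BegPos_anti {T x y : List α} (h : x <+: y) : BegPos T y ⊆ BegPos T x := fun i hi => by
  rw [mem_BegPos_s9] at hi ⊢
  exact ⟨hi.1, h.trans hi.2⟩

/-- `i` and `j` are occurrences of `w` in `T` which are not followed by the same character. -/
def Diverge (T w : List α) (i j : ℕ) : Prop :=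
  i ∈ BegPos T w ∧ j ∈ BegPos T w ∧ ∀ a, ¬ (i ∈ BegPos T (w ++ [a]) ∧ j ∈ BegPos T (w ++ [a]))

theorem Diverge.symm {T w : List α} {i j : ℕ} (h : Diverge T w i j) : Diverge T w j i :=
  ⟨h.2.1, h.1, fun a ha => h.2.2 a ha.symm⟩

theorem IsMaxRep.exists_diverge {T w : List α} (h : IsMaxRep T w) :
    ∃ j, ∃ i < j, Diverge T w i j := by
  suffices ∃ i k, i ≠ k ∧ Diverge T w i k by
    obtain ⟨i, k, hne, hd⟩ := this
    rcases hne.lt_or_gt with hlt | hlt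
    · exact ⟨k, i, hlt, hd⟩
    · exact ⟨i, k, hlt, hd.symm⟩
  obtain ⟨i, hi, k, hk, hne⟩ := Finset.one_lt_card.mp h.1
  by_cases hext : ∃ a, i ∈ BegPos T (w ++ [a])
  · obtain ⟨a, ha⟩ := hext
    obtain ⟨m, hm, hma⟩ := Finset.exists_mem_notMem_of_card_lt_card (h.2 a).1
    refine ⟨i, m, fun him => hma (him ▸ ha), hi, hm, fun b hb => hma ?_⟩
    have hab := List.eq_of_append_singleton_isPrefix (mem_BegPos_s9.mp ha).2 (mem_BegPos_s9.mp hb.1).2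
    exact hab ▸ hb.2
  · exact ⟨i, k, hne, hi, hk, fun a ha => hext ⟨a, ha.1⟩⟩

open Classical in
/-- The first occurrence of `w` in `T` that diverges from an earlier one
(`0` if there is none). -/
noncomputable def firstDiverge (T w : List α) : ℕ :=
  if h : ∃ j, ∃ i < j, Diverge T w i j then Nat.find h else 0

theorem IsMaxRep.firstDiverge_spec {T w : List α} (h : IsMaxRep T w) :
    ∃ i < firstDiverge T w, Diverge T w i (firstDiverge T w) := by
  classical
  rw [firstDiverge, dif_pos h.exists_diverge]
  exact Nat.find_spec h.exists_diverge

theorem Diverge.firstDiverge_le {T w : List α} {i j : ℕ} (h : Diverge T w i j) (hij : i < j) :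
    firstDiverge T w ≤ j := by
  classical
  have hex : ∃ j, ∃ i < j, Diverge T w i j := ⟨j, i, hij, h⟩
  rw [firstDiverge, dif_pos hex]
  exact Nat.find_min' hex ⟨i, hij, h⟩

theorem firstDiverge_ne_of_append_isPrefix {T w v : List α} {a : α} (hw : IsMaxRep T w)
    (hv : IsMaxRep T v) (h : w ++ [a] <+: v) : firstDiverge T w ≠ firstDiverge T v := by
  intro heq
  obtain ⟨i, hi, hid⟩ := hw.firstDiverge_spec
  obtain ⟨k, hk, hkd⟩ := hv.firstDiverge_spec
  rw [← heq] at hk hkd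
  have hka := BegPos_anti h hkd.1
  have hja := BegPos_anti h hkd.2.1
  have hia : i ∉ BegPos T (w ++ [a]) := fun hia => hid.2.2 a ⟨hia, hja⟩
  have hik : Diverge T w i k := by
    refine ⟨hid.1, BegPos_anti (List.prefix_append w [a]) hka, fun b hb => hia ?_⟩
    have hab := List.eq_of_append_singleton_isPrefix (mem_BegPos_s9.mp hka).2 (mem_BegPos_s9.mp hb.2).2
    exact hab ▸ hb.1
  rcases lt_trichotomy i k with hlt | rfl | hlt
  · exact absurd (hik.firstDiverge_le hlt) (by omega)
  · exact hia hka
  · exact absurd (hik.symm.firstDiverge_le hlt) (by omega)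

theorem injOn_firstDiverge (T : List α) : Set.InjOn (firstDiverge T) {w | IsMaxRep T w} := by
  intro w hw v hv heq
  obtain ⟨_, _, hwd⟩ := IsMaxRep.firstDiverge_spec hw
  obtain ⟨_, _, hvd⟩ := IsMaxRep.firstDiverge_spec hv
  have hvp := (mem_BegPos_s9.mp hvd.2.1).2
  rw [← heq] at hvp
  rcases List.eq_or_append_singleton_isPrefix (mem_BegPos_s9.mp hwd.2.1).2 hvp with
    h | ⟨a, h⟩ | ⟨a, h⟩
  · exact h
  · exact absurd heq (firstDiverge_ne_of_append_isPrefix hw hv h)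
  · exact absurd heq.symm (firstDiverge_ne_of_append_isPrefix hv hw h)

theorem mapsTo_firstDiverge (T : List α) :
    Set.MapsTo (firstDiverge T) {w | IsMaxRep T w} (Finset.Icc 1 T.length : Finset ℕ) := by
  intro w hw
  obtain ⟨i, hi, hd⟩ := IsMaxRep.firstDiverge_spec hw
  have hlt := (mem_BegPos_s9.mp hd.2.1).1
  simp only [Finset.coe_Icc, Set.mem_Icc]
  omega

theorem finite_setOf_isMaxRep (T : List α) : {w | IsMaxRep T w}.Finite :=
  Set.Finite.of_injOn (mapsTo_firstDiverge T) (injOn_firstDiverge T) (Finset.finite_toSet _)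

theorem ncard_setOf_isMaxRep_le (T : List α) : {w | IsMaxRep T w}.ncard ≤ T.length := by
  have h := Set.ncard_le_ncard_of_injOn _ (mapsTo_firstDiverge T) (injOn_firstDiverge T)
    (Finset.finite_toSet _)
  rwa [Set.ncard_coe_finset, Nat.card_Icc, Nat.add_sub_cancel] at h

theorem isMaxRep_nil {T : List α} (hT : 1 ≤ T.length) : IsMaxRep T [] := by
  have hlt (a : α) : occ T [a] < occ T [] := by
    refine Finset.card_lt_card (Finset.ssubset_iff_of_subset
      (BegPos_anti List.nil_prefix) |>.mpr ⟨T.length, ?_, ?_⟩) <;> simp [mem_BegPos_s9]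
  refine ⟨?_, fun a => ⟨hlt a, hlt a⟩⟩
  simp [occ, BegPos, hT]

end

theorem stmt9 {α : Type*} [Fintype α] [DecidableEq α] (T : List α) (hT : 1 ≤ T.length) :
    {w : List α | IsMaxRep T w ∧ w ≠ []}.ncard < T.length := by
  refine lt_of_lt_of_le (Set.ncard_lt_ncard ?_ (finite_setOf_isMaxRep T))
    (ncard_setOf_isMaxRep_le T)
  exact ⟨fun w hw => hw.1, fun h => (h (isMaxRep_nil hT)).2 rfl⟩
end

section
/- For any string T of length n ≥ 2, ẽ_T ≤ 4n − 4; that is, the total number of distinct right and left extensions of maximal repeats of T is at most 4n − 4. -/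
/-- A repeat `w` of `T` every right extension of which occurs strictly fewer times than `w`. -/
def IsRightMaxRep {α : Type*} [DecidableEq α] (T w : List α) : Prop :=
  2 ≤ occ T w ∧ ∀ a : α, occ T (w ++ [a]) < occ T w

open Classical in
/-- The right extensions `w·a` of right-maximal repeats `w` of `T` having `x` as a prefix. -/
noncomputable def rightExtFrom {α : Type*} [DecidableEq α] (T x : List α) : Finset (List α) :=
  T.sublists.toFinset.filter
    (fun y => ∃ (w : List α) (a : α), IsRightMaxRep T w ∧ x <+: w ∧ y = w ++ [a] ∧ 1 ≤ occ T y)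

/-- The letters that can follow an occurrence of `x` in `T`. -/
def nextLetters {α : Type*} [Fintype α] [DecidableEq α] (T x : List α) : Finset α :=
  Finset.univ.filter (fun a => 1 ≤ occ T (x ++ [a]))

section Occurrences

variable {α : Type*} [DecidableEq α] {T x y : List α}

theorem occ_eq_sum (T x : List α) :
    occ T x = ∑ i ∈ Finset.range (T.length + 1), if x <+: T.drop i then 1 else 0 := by
  rw [occ, BegPos, Finset.card_filter]

theorem sum_ite_eq_drop (T x : List α) :
    (∑ i ∈ Finset.range (T.length + 1), if x = T.drop i then 1 else 0) =
      if x <:+ T then 1 else 0 := by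
  split_ifs with h
  · have hl := h.length_le
    rw [Finset.sum_eq_single (T.length - x.length)]
    · rw [if_pos (List.suffix_iff_eq_drop.1 h)]
    · intro i hi hne
      rw [if_neg]
      intro e
      have := congrArg List.length e
      rw [List.length_drop] at this
      rw [Finset.mem_range] at hi
      omega
    · intro hi
      exact absurd (Finset.mem_range.2 (by omega)) hi
  · refine Finset.sum_eq_zero fun i _ => if_neg fun e => h ?_
    rw [e]
    exact List.drop_suffix i T

theorem occ_pos_iff_isInfix : 1 ≤ occ T x ↔ x <:+: T := by
  rw [occ, Nat.one_le_iff_ne_zero, Finset.card_ne_zero]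
  constructor
  · rintro ⟨i, hi⟩
    exact (Finset.mem_filter.1 hi).2.isInfix.trans (List.drop_suffix i T).isInfix
  · rintro ⟨s, t, rfl⟩
    refine ⟨s.length, Finset.mem_filter.2 ⟨?_, ?_⟩⟩
    · simp
    · simp

theorem occ_anti (h : x <+: y) : occ T y ≤ occ T x :=
  Finset.card_le_card fun i hi => by
    rw [BegPos, Finset.mem_filter] at hi ⊢
    exact ⟨hi.1, h.trans hi.2⟩

theorem occ_nil : occ T [] = T.length + 1 := by
  simp [occ, BegPos]

theorem occ_le_occ_reverse (T x : List α) : occ T x ≤ occ T.reverse x.reverse := by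
  have key : ∀ i ∈ BegPos T x, i + x.length ≤ T.length := by
    intro i hi
    rw [BegPos, Finset.mem_filter, Finset.mem_range] at hi
    have := hi.2.length_le
    rw [List.length_drop] at this
    omega
  refine Finset.card_le_card_of_injOn (fun i => T.length - x.length - i) ?_ ?_
  · intro i hi
    have hlen := key i hi
    rw [Finset.mem_coe, BegPos, Finset.mem_filter] at hi ⊢
    obtain ⟨-, r, hr⟩ := hi
    refine ⟨by simp; omega, ?_⟩
    have hT : T = T.take i ++ (x ++ r) := by rw [hr, List.take_append_drop]
    have hrl : T.length - x.length - i = r.reverse.length := by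
      have := congrArg List.length hr
      simp only [List.length_append, List.length_drop] at this
      rw [List.length_reverse]
      omega
    simp only [hrl]
    rw [hT]
    simp only [List.reverse_append, List.append_assoc, List.drop_left]
    exact List.prefix_append _ _
  · intro i hi j hj hij
    have h₁ := key i hi
    have h₂ := key j hj
    simp only at hij
    omega

theorem occ_reverse (T x : List α) : occ T.reverse x.reverse = occ T x :=
  le_antisymm (by simpa using occ_le_occ_reverse T.reverse x.reverse) (occ_le_occ_reverse T x)

theorem IsMaxRep.isRightMaxRep {w : List α} (h : IsMaxRep T w) : IsRightMaxRep T w :=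
  ⟨h.1, fun a => (h.2 a).1⟩

theorem IsMaxRep.reverse {w : List α} (h : IsMaxRep T w) : IsMaxRep T.reverse w.reverse := by
  refine ⟨by rw [occ_reverse]; exact h.1, fun a => ⟨?_, ?_⟩⟩
  · rw [← List.reverse_cons, occ_reverse, occ_reverse]
    exact (h.2 a).2
  · rw [← List.reverse_concat, occ_reverse, occ_reverse]
    exact (h.2 a).1

theorem leftExtSet_subset (T : List α) :
    LeftExtSet T ⊆ List.reverse '' RightExtSet T.reverse := by
  rintro x ⟨w, a, hw, rfl, hx⟩
  refine ⟨w.reverse ++ [a], ⟨w.reverse, a, hw.reverse, rfl, ?_⟩, by simp⟩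
  rwa [← List.reverse_cons, occ_reverse]

theorem mem_rightExtFrom : y ∈ rightExtFrom T x ↔
    ∃ (w : List α) (a : α), IsRightMaxRep T w ∧ x <+: w ∧ y = w ++ [a] ∧ 1 ≤ occ T y := by
  classical
  rw [rightExtFrom, Finset.mem_filter, and_iff_right_iff_imp]
  rintro ⟨w, a, -, -, -, h⟩
  simpa using (occ_pos_iff_isInfix.1 h).sublist

theorem rightExtSet_subset (T : List α) : RightExtSet T ⊆ rightExtFrom T [] := by
  rintro x ⟨w, a, hw, hx, h⟩
  exact mem_rightExtFrom.2 ⟨w, a, hw.isRightMaxRep, List.nil_prefix, hx, h⟩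

theorem rightExtFrom_eq_empty (h : occ T x ≤ 1) : rightExtFrom T x = ∅ := by
  rw [Finset.eq_empty_iff_forall_notMem]
  intro y hy
  obtain ⟨w, a, hw, hxw, -⟩ := mem_rightExtFrom.1 hy
  have := occ_anti (T := T) hxw
  have := hw.1
  omega

end Occurrences

section Counting

variable {α : Type*} [Fintype α] [DecidableEq α] {T x : List α}

theorem mem_nextLetters {a : α} : a ∈ nextLetters T x ↔ 1 ≤ occ T (x ++ [a]) := by
  simp [nextLetters]

theorem ite_prefix_eq (x l : List α) : (if x <+: l then 1 else 0) =
    (if x = l then 1 else 0) + ∑ a : α, if x ++ [a] <+: l then 1 else 0 := by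
  by_cases h : x <+: l
  · obtain ⟨r, rfl⟩ := h
    cases r with
    | nil =>
      have h : ∀ a : α, ¬ x ++ [a] <+: x := fun a ha => by simpa using ha.length_le
      simp [h]
    | cons b r => simp [List.prefix_append_right_inj, List.cons_prefix_cons]
  · have h₁ : x ≠ l := fun e => h (e ▸ List.prefix_rfl)
    have h₂ : ∀ a : α, ¬ x ++ [a] <+: l := fun a ha => h ((List.prefix_append x [a]).trans ha)
    simp [h, h₁, h₂]

theorem occ_eq_add_sum (T x : List α) :
    occ T x = (if x <:+ T then 1 else 0) + ∑ a : α, occ T (x ++ [a]) := by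
  rw [occ_eq_sum, Finset.sum_congr rfl fun i _ => ite_prefix_eq x (T.drop i),
    Finset.sum_add_distrib, sum_ite_eq_drop, Finset.sum_comm]
  simp only [occ_eq_sum]

theorem sum_nextLetters (T x : List α) :
    ∑ a ∈ nextLetters T x, occ T (x ++ [a]) = ∑ a : α, occ T (x ++ [a]) := by
  refine Finset.sum_subset (Finset.subset_univ _) fun a _ ha => ?_
  rw [mem_nextLetters] at ha
  omega

theorem rightExtFrom_subset_biUnion (h : ¬ IsRightMaxRep T x) :
    rightExtFrom T x ⊆ (nextLetters T x).biUnion fun a => rightExtFrom T (x ++ [a]) := by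
  intro y hy
  obtain ⟨w, b, hw, ⟨r, rfl⟩, hy, hy'⟩ := mem_rightExtFrom.1 hy
  cases r with
  | nil => exact absurd (by simpa using hw) h
  | cons c r =>
    have hp : x ++ [c] <+: x ++ c :: r := ⟨r, by simp⟩
    refine Finset.mem_biUnion.2 ⟨c, mem_nextLetters.2 ?_, mem_rightExtFrom.2
      ⟨_, b, hw, hp, hy, hy'⟩⟩
    have := occ_anti (T := T) hp
    have := hw.1
    omega

theorem rightExtFrom_subset_union (T x : List α) :
    rightExtFrom T x ⊆ (nextLetters T x).image (fun a => x ++ [a]) ∪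
      (nextLetters T x).biUnion fun a => rightExtFrom T (x ++ [a]) := by
  intro y hy
  obtain ⟨w, b, hw, ⟨r, rfl⟩, rfl, hy'⟩ := mem_rightExtFrom.1 hy
  cases r with
  | nil =>
    refine Finset.mem_union_left _ (Finset.mem_image.2 ⟨b, mem_nextLetters.2 ?_, by simp⟩)
    simpa using hy'
  | cons c r =>
    have hp : x ++ [c] <+: x ++ c :: r := ⟨r, by simp⟩
    refine Finset.mem_union_right _ (Finset.mem_biUnion.2 ⟨c, mem_nextLetters.2 ?_,
      mem_rightExtFrom.2 ⟨_, b, hw, hp, rfl, hy'⟩⟩)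
    have := occ_anti (T := T) hp
    have := hw.1
    omega

theorem card_rightExtFrom_le (T x : List α) :
    (rightExtFrom T x).card ≤ (nextLetters T x).card +
      ∑ a ∈ nextLetters T x, (rightExtFrom T (x ++ [a])).card :=
  (Finset.card_le_card (rightExtFrom_subset_union T x)).trans <|
    (Finset.card_union_le _ _).trans <|
      Nat.add_le_add Finset.card_image_le Finset.card_biUnion_le

theorem card_rightExtFrom_add_le
    (ih : ∀ a ∈ nextLetters T x, (rightExtFrom T (x ++ [a])).card + 2 ≤ 2 * occ T (x ++ [a])) :
    (rightExtFrom T x).card + (nextLetters T x).card + 2 * (if x <:+ T then 1 else 0) ≤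
      2 * occ T x := by
  have h₁ := Finset.sum_le_sum ih
  rw [Finset.sum_add_distrib, Finset.sum_const, smul_eq_mul, ← Finset.mul_sum,
    sum_nextLetters] at h₁
  have h₂ := card_rightExtFrom_le T x
  have h₃ := occ_eq_add_sum T x
  omega

theorem two_le_card_nextLetters (hs : ¬ x <:+ T) (h : IsRightMaxRep T x) :
    2 ≤ (nextLetters T x).card := by
  have h₁ := occ_eq_add_sum T x
  rw [if_neg hs, zero_add, ← sum_nextLetters] at h₁
  have h₂ := h.1
  by_contra hlt
  obtain h0 | h0 : (nextLetters T x).card = 0 ∨ (nextLetters T x).card = 1 := by omega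
  · rw [Finset.card_eq_zero] at h0
    rw [h0, Finset.sum_empty] at h₁
    omega
  · obtain ⟨a, ha⟩ := Finset.card_eq_one.1 h0
    rw [ha, Finset.sum_singleton] at h₁
    have := h.2 a
    omega

theorem nextLetters_eq_singleton {a : α} (h : occ T x ≤ occ T (x ++ [a])) (hx : 1 ≤ occ T x) :
    nextLetters T x = {a} := by
  ext b
  rw [mem_nextLetters, Finset.mem_singleton]
  constructor
  · intro hb
    by_contra hne
    have h₁ := occ_eq_add_sum T x
    have h₂ := Finset.sum_le_sum_of_subset (f := fun a => occ T (x ++ [a]))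
      (Finset.subset_univ {a, b})
    rw [Finset.sum_pair (Ne.symm hne)] at h₂
    omega
  · rintro rfl
    omega

theorem card_rightExtFrom_add_two_le (T x : List α) (hx : 1 ≤ occ T x) :
    (rightExtFrom T x).card + 2 ≤ 2 * occ T x := by
  have hlen := (occ_pos_iff_isInfix.1 hx).length_le
  have ih : ∀ a ∈ nextLetters T x,
      (rightExtFrom T (x ++ [a])).card + 2 ≤ 2 * occ T (x ++ [a]) :=
    fun a ha => card_rightExtFrom_add_two_le T (x ++ [a]) (mem_nextLetters.1 ha)
  by_cases h1 : occ T x ≤ 1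
  · rw [rightExtFrom_eq_empty h1, Finset.card_empty]
    omega
  by_cases hm : IsRightMaxRep T x
  · have h := card_rightExtFrom_add_le ih
    by_cases hs : x <:+ T
    · rw [if_pos hs] at h
      omega
    · have := two_le_card_nextLetters hs hm
      omega
  · obtain ⟨a, ha⟩ : ∃ a, occ T x ≤ occ T (x ++ [a]) := by
      by_contra! hc
      exact hm ⟨by omega, hc⟩
    have hK := nextLetters_eq_singleton ha hx
    have h₁ := Finset.card_le_card (rightExtFrom_subset_biUnion hm)
    rw [hK, Finset.singleton_biUnion] at h₁
    have h₂ := ih a (by simp [hK])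
    have := occ_anti (T := T) (List.prefix_append x [a])
    omega
termination_by T.length + 1 - x.length
decreasing_by
  rw [List.length_append, List.length_singleton]
  omega

theorem card_rightExtFrom_of_suffix (hs : x <:+ T) :
    (rightExtFrom T x).card + (nextLetters T x).card + 2 ≤ 2 * occ T x := by
  simpa [hs] using card_rightExtFrom_add_le (T := T) (x := x)
    fun a ha => card_rightExtFrom_add_two_le T (x ++ [a]) (mem_nextLetters.1 ha)

theorem nextLetters_nonempty_of_suffix (hs : x <:+ T) (h : 2 ≤ occ T x) :
    (nextLetters T x).Nonempty := by
  rw [Finset.nonempty_iff_ne_empty]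
  intro he
  have h₁ := occ_eq_add_sum T x
  rw [if_pos hs, ← sum_nextLetters, he, Finset.sum_empty] at h₁
  omega

theorem card_rightExtFrom_nil_le (hT : 2 ≤ T.length) :
    (rightExtFrom T []).card + 2 ≤ 2 * T.length := by
  have hnil : ([] : List α) <:+ T := List.nil_suffix
  have h₀ := card_rightExtFrom_of_suffix hnil
  rw [occ_nil] at h₀
  by_cases hk : 2 ≤ (nextLetters T []).card
  · omega
  obtain ⟨l, b, rfl⟩ : ∃ l b, T = l ++ [b] := by
    rcases T.eq_nil_or_concat with rfl | ⟨l, b, h⟩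
    · simp at hT
    · exact ⟨l, b, by simpa using h⟩
  have hs : [b] <:+ l ++ [b] := List.suffix_append _ _
  have hb : b ∈ nextLetters (l ++ [b]) [] :=
    mem_nextLetters.2 (occ_pos_iff_isInfix.2 hs.isInfix)
  have hK : nextLetters (l ++ [b]) [] = {b} :=
    (Finset.eq_singleton_iff_unique_mem.2 ⟨hb, fun c hc =>
      Finset.card_le_one.1 (by omega) c hc b hb⟩)
  have h₁ := occ_eq_add_sum (l ++ [b]) []
  rw [if_pos hnil, occ_nil, ← sum_nextLetters, hK, Finset.sum_singleton, List.nil_append] at h₁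
  have h₂ := card_rightExtFrom_le (l ++ [b]) []
  rw [hK, Finset.sum_singleton, Finset.card_singleton, List.nil_append] at h₂
  have h₃ := card_rightExtFrom_of_suffix hs
  have h₄ := (nextLetters_nonempty_of_suffix hs (by omega)).card_pos
  omega

theorem ncard_rightExtSet_le (hT : 2 ≤ T.length) :
    (RightExtSet T).ncard + 2 ≤ 2 * T.length := by
  have h := Set.ncard_le_ncard (rightExtSet_subset T) (Finset.finite_toSet _)
  rw [Set.ncard_coe_finset] at h
  have := card_rightExtFrom_nil_le hT
  omega

theorem ncard_leftExtSet_le (hT : 2 ≤ T.length) :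
    (LeftExtSet T).ncard + 2 ≤ 2 * T.length := by
  have hfin : (RightExtSet T.reverse).Finite :=
    (Finset.finite_toSet _).subset (rightExtSet_subset _)
  have h₁ := Set.ncard_le_ncard (leftExtSet_subset T) (hfin.image _)
  have h₂ := Set.ncard_image_le (f := List.reverse) hfin
  have h₃ := ncard_rightExtSet_le (T := T.reverse) (by simpa using hT)
  rw [List.length_reverse] at h₃
  omega

end Counting

theorem stmt10 {α : Type*} [Fintype α] [DecidableEq α] (T : List α) (hT : 2 ≤ T.length) :
    (RightExtSet T).ncard + (LeftExtSet T).ncard ≤ 4 * T.length - 4 := by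
  have h₁ := ncard_rightExtSet_le hT
  have h₂ := ncard_leftExtSet_le hT
  omega
end
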